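/- (Gessel–Lucas congruence for Zagier's sequence D.) Let A_D(n) = \sum_{k=0}^{n} \binom{n}{k}^2 \binom{n+k}{k} and define the rational sequence A_D'(n) = 5 \sum_{k=0}^{n} \binom{n}{k}^2 \binom{n+k}{k} (H_n - H_k), where H_m is the m-th harmonic number. Then for every prime p \ge 3 and all integers n \ge 0 and k with 0 \le k < p, the rational number A_D(p n + k) - A_D(k) A_D(n) - p n A_D'(k) A_D(n) has p-adic valuation at least 2; that is, A_D(p n + k) \equiv A_D(k) A_D(n) + p n A_D'(k) A_D(n) (mod p^2) in the p-adic sense. -/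

import Mathlib

/-- The `m`-th harmonic number. -/
def harm (m : ℕ) : ℚ := ∑ j ∈ Finset.range m, 1 / (j + 1)

/-- Zagier's sporadic sequence D (as rationals). -/
def aperyD (n : ℕ) : ℚ :=
  ∑ k ∈ Finset.range (n + 1), (n.choose k : ℚ) ^ 2 * ((n + k).choose k : ℚ)

/-- The formal derivative of Zagier's sporadic sequence D. -/
def aperyD' (n : ℕ) : ℚ :=
  5 * ∑ k ∈ Finset.range (n + 1),
    (n.choose k : ℚ) ^ 2 * ((n + k).choose k : ℚ) * (harm n - harm k)

open Finset

/-- The summand of Zagier's sequence D. -/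
def aperyDTerm (n k : ℕ) : ℚ := (n.choose k : ℚ) ^ 2 * ((n + k).choose k : ℚ)

lemma aperyDTerm_eq_zero {n k : ℕ} (h : n < k) : aperyDTerm n k = 0 := by
  simp [aperyDTerm, Nat.choose_eq_zero_of_lt h]

lemma aperyDTerm_zero_right (n : ℕ) : aperyDTerm n 0 = 1 := by simp [aperyDTerm]

lemma harm_succ (m : ℕ) : harm (m + 1) = harm m + 1 / ((m : ℚ) + 1) :=
  Finset.sum_range_succ _ _

lemma sum_aperyDTerm_mul {n M : ℕ} (h : n < M) (g : ℕ → ℚ) :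
    ∑ k ∈ range M, aperyDTerm n k * g k = ∑ k ∈ range (n + 1), aperyDTerm n k * g k := by
  symm
  apply Finset.sum_subset (range_mono (by omega))
  intro k _ hk
  rw [aperyDTerm_eq_zero (by simpa using hk), zero_mul]

lemma aperyD_eq_sum {n M : ℕ} (h : n < M) : aperyD n = ∑ k ∈ range M, aperyDTerm n k := by
  have e := (sum_aperyDTerm_mul h fun _ => 1).symm
  simp only [mul_one] at e
  exact e

lemma aperyD'_eq_sum {n M : ℕ} (h : n < M) :
    aperyD' n = 5 * ∑ k ∈ range M, aperyDTerm n k * (harm n - harm k) := by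
  rw [sum_aperyDTerm_mul h, aperyD']
  rfl

lemma choose_eq_div (n k : ℕ) :
    (n.choose k : ℚ) = (n + 1 - k) / (n + 1) * ((n + 1).choose k : ℚ) := by
  have hn : (n : ℚ) + 1 ≠ 0 := by positivity
  rcases le_or_gt k (n + 1) with h | h
  · have e : ((n.choose k * (n + 1) : ℕ) : ℚ) = ((n + 1).choose k * (n + 1 - k) : ℕ) := by
      rw [Nat.choose_mul_succ_eq]
    push_cast [Nat.cast_sub h] at e
    field_simp
    linear_combination e
  · simp [Nat.choose_eq_zero_of_lt h, Nat.choose_eq_zero_of_lt (by omega : n < k)]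

lemma choose_add_eq_div (n k : ℕ) :
    ((n + 1 + k).choose k : ℚ) = (n + k + 1) / (n + 1) * ((n + k).choose k : ℚ) := by
  have hn : (n : ℚ) + 1 ≠ 0 := by positivity
  have e := choose_eq_div (n + k) k
  have hk : (n : ℚ) + k + 1 ≠ 0 := by positivity
  rw [e, show n + 1 + k = n + k + 1 by ring]
  push_cast
  field_simp
  ring

/-- The terms entering the recurrence, as multiples of a common quantity. -/
lemma exists_aperyDTerm_eq (n k : ℕ) : ∃ c : ℚ,
    aperyDTerm (n + 2) (k + 1) = (n + 1) * (n + 2) * (n + k + 2) * (n + k + 3) * c ∧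
    aperyDTerm (n + 1) (k + 1) = (n + 1) * (n + k + 2) * (n + 1 - k) ^ 2 * c ∧
    aperyDTerm n (k + 1) = ((n + 1 - k) * (n - k)) ^ 2 * c ∧
    aperyDTerm (n + 1) k = (n + 1) * (k + 1) ^ 3 * c := by
  have h1 : (n : ℚ) + 1 ≠ 0 := by positivity
  have h2 : (n : ℚ) + 2 ≠ 0 := by positivity
  have hk : (k : ℚ) + 1 ≠ 0 := by positivity
  have a1 := choose_eq_div (n + 1) (k + 1)
  have a0 := choose_eq_div n (k + 1)
  have ak : ((n + 1).choose k : ℚ) = (k + 1) / (n + 2) * ((n + 2).choose (k + 1) : ℚ) := by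
    have e : (((n + 1 + 1) * (n + 1).choose k : ℕ) : ℚ) =
        ((n + 1 + 1).choose (k + 1) * (k + 1) : ℕ) := by rw [Nat.add_one_mul_choose_eq]
    push_cast at e
    field_simp
    linear_combination e
  have b1 := choose_add_eq_div (n + 1) (k + 1)
  have b0 := choose_add_eq_div n (k + 1)
  have bk : ((n + 1 + k).choose k : ℚ) =
      (k + 1) / (n + 1) * ((n + (k + 1)).choose (k + 1) : ℚ) := by
    have e : (((n + 1 + k).choose (k + 1) * (k + 1) : ℕ) : ℚ) =
        ((n + 1 + k).choose k * (n + 1 + k - k) : ℕ) := by rw [Nat.choose_succ_right_eq]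
    rw [Nat.add_sub_cancel, show n + 1 + k = n + (k + 1) by ring] at e
    rw [show n + 1 + k = n + (k + 1) by ring]
    push_cast at e
    field_simp
    linear_combination -e
  push_cast at a1 a0 b1 b0
  simp only [aperyDTerm]
  refine ⟨((n + 2).choose (k + 1) : ℚ) ^ 2 * ((n + (k + 1)).choose (k + 1) : ℚ) /
    ((n + 1) * (n + 2)) ^ 2, ?_, ?_, ?_, ?_⟩
  · rw [show n + 2 = n + 1 + 1 by rfl, b1, b0]
    field_simp
    ring
  · rw [b0, a1]
    field_simp
    ring
  · rw [a0, a1]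
    field_simp
    ring
  · rw [ak, bk]
    field_simp

lemma aperyDTerm_recurrence_sum (n K : ℕ) :
    ∑ k ∈ range (K + 1), ((n + 2) ^ 2 * aperyDTerm (n + 2) k
      - (11 * (n + 1) ^ 2 + 11 * (n + 1) + 3) * aperyDTerm (n + 1) k
      - (n + 1) ^ 2 * aperyDTerm n k) =
    ((K : ℚ) ^ 2 + 3 * (2 * n + 3) * K - 11 * (n + 1) ^ 2 - 9 * (n + 1) - 2)
      * aperyDTerm (n + 1) K := by
  induction K with
  | zero =>
    simp only [zero_add, sum_range_one, aperyDTerm_zero_right]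
    push_cast
    ring
  | succ K ih =>
    rw [sum_range_succ, ih]
    obtain ⟨c, h2, h1, h0, hk⟩ := exists_aperyDTerm_eq n K
    rw [h2, h1, h0, hk]
    push_cast
    ring

lemma aperyDTerm_deriv_recurrence_sum (n K : ℕ) :
    ∑ k ∈ range (K + 1),
      (5 * ((n + 2) ^ 2 * (aperyDTerm (n + 2) k * (harm (n + 2) - harm k))
        - (11 * (n + 1) ^ 2 + 11 * (n + 1) + 3) *
          (aperyDTerm (n + 1) k * (harm (n + 1) - harm k))
        - (n + 1) ^ 2 * (aperyDTerm n k * (harm n - harm k)))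
      + 2 * (n + 2) * aperyDTerm (n + 2) k - (22 * (n + 1) + 11) * aperyDTerm (n + 1) k
      - 2 * (n + 1) * aperyDTerm n k) =
    (5 * ((K : ℚ) ^ 2 + 3 * (2 * n + 3) * K - 11 * (n + 1) ^ 2 - 9 * (n + 1) - 2) *
        (harm (n + 1) - harm K)
      + 4 * (-2 * K ^ 2 / (n + 1) + 3 * K - 3 * (n + 1) - 1)) * aperyDTerm (n + 1) K := by
  have hn : (n : ℚ) + 1 ≠ 0 := by positivity
  have hn2 : (n : ℚ) + 2 ≠ 0 := by positivity
  have e1 := harm_succ n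
  have e2 : harm (n + 2) = harm (n + 1) + 1 / ((n : ℚ) + 2) := by
    rw [harm_succ (n + 1)]
    push_cast
    ring
  rw [e2, e1]
  induction K with
  | zero =>
    simp only [zero_add, sum_range_one, aperyDTerm_zero_right]
    push_cast
    field_simp
    ring
  | succ K ih =>
    have hK : (K : ℚ) + 1 ≠ 0 := by positivity
    rw [sum_range_succ, ih, harm_succ K]
    obtain ⟨c, h2, h1, h0, hk⟩ := exists_aperyDTerm_eq n K
    rw [h2, h1, h0, hk]
    push_cast
    field_simp
    ring

lemma aperyD_recurrence (n : ℕ) :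
    (n + 2) ^ 2 * aperyD (n + 2) = (11 * (n + 1) ^ 2 + 11 * (n + 1) + 3) * aperyD (n + 1)
      + (n + 1) ^ 2 * aperyD n := by
  have h := aperyDTerm_recurrence_sum n (n + 2)
  simp only [sum_sub_distrib, ← mul_sum] at h
  rw [aperyDTerm_eq_zero (by omega : n + 1 < n + 2), ← aperyD_eq_sum (by omega),
    ← aperyD_eq_sum (by omega), ← aperyD_eq_sum (by omega)] at h
  linear_combination h

lemma aperyD'_recurrence (n : ℕ) :
    (n + 2) ^ 2 * aperyD' (n + 2) + 2 * (n + 2) * aperyD (n + 2) =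
      (11 * (n + 1) ^ 2 + 11 * (n + 1) + 3) * aperyD' (n + 1)
      + (22 * (n + 1) + 11) * aperyD (n + 1)
      + (n + 1) ^ 2 * aperyD' n + 2 * (n + 1) * aperyD n := by
  have h := aperyDTerm_deriv_recurrence_sum n (n + 2)
  simp only [sum_sub_distrib, sum_add_distrib, ← mul_sum] at h
  rw [aperyDTerm_eq_zero (by omega : n + 1 < n + 2), ← aperyD_eq_sum (by omega),
    ← aperyD_eq_sum (by omega), ← aperyD_eq_sum (by omega)] at h
  rw [aperyD'_eq_sum (by omega : n + 2 < n + 2 + 1),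
    aperyD'_eq_sum (by omega : n + 1 < n + 2 + 1), aperyD'_eq_sum (by omega : n < n + 2 + 1)]
  linear_combination h

lemma aperyD_zero : aperyD 0 = 1 := by simp [aperyD]

lemma aperyD_one : aperyD 1 = 3 := by norm_num [aperyD, sum_range_succ]

lemma aperyD'_zero : aperyD' 0 = 0 := by simp [aperyD']

lemma aperyD'_one : aperyD' 1 = 5 := by norm_num [aperyD', sum_range_succ, harm]

section Supercongruence

lemma sum_range_mul_modEq {p : ℕ} (hp : 0 < p) (m q : ℕ) (f : ℕ → ℕ)
    (hf : ∀ j, ¬ p ∣ j → q ∣ f j) :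
    ∑ j ∈ range (p * m), f j ≡ ∑ i ∈ range m, f (p * i) [MOD q] := by
  obtain ⟨r, rfl⟩ := Nat.exists_eq_succ_of_ne_zero hp.ne'
  induction m with
  | zero => simp; rfl
  | succ m ih =>
    rw [Nat.mul_succ, sum_range_add, sum_range_succ _ m]
    refine ih.add ?_
    rw [sum_range_succ']
    have h : q ∣ ∑ k ∈ range r, f (r.succ * m + (k + 1)) := by
      refine dvd_sum fun k hk => hf _ fun h => ?_
      rw [Nat.dvd_add_right (Dvd.intro _ rfl)] at h
      have := Nat.le_of_dvd (by omega) h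
      have := mem_range.1 hk
      omega
    simpa using ((Nat.modEq_zero_iff_dvd.2 h).add_right (f (r.succ * m)))

variable {p : ℕ}

lemma Nat.Prime.dvd_choose_mul_of_not_dvd (hp : p.Prime) (n : ℕ) {j : ℕ} (hj : ¬ p ∣ j) :
    p ∣ (p * n).choose j := by
  rcases j with _ | j
  · simp at hj
  rcases Nat.eq_zero_or_pos n with rfl | hn
  · simp
  obtain ⟨N, hN⟩ := Nat.exists_eq_succ_of_ne_zero (Nat.mul_pos hp.pos hn).ne'
  have e := Nat.add_one_mul_choose_eq N j
  rw [← Nat.succ_eq_add_one N, ← hN] at e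
  have h : p ∣ (p * n).choose (j + 1) * (j + 1) :=
    e ▸ Dvd.dvd.mul_right (Dvd.intro _ rfl) _
  exact (hp.dvd_mul.1 h).resolve_right hj

lemma Nat.Prime.choose_mul_modEq_sq (hp : p.Prime) (n k : ℕ) :
    (p * n).choose (p * k) ≡ n.choose k [MOD p ^ 2] := by
  induction n generalizing k with
  | zero =>
    rcases k with _ | k
    · simp; rfl
    · simp [Nat.choose_eq_zero_of_lt (Nat.mul_pos hp.pos k.succ_pos)]; rfl
  | succ n ih =>
    rcases k with _ | k
    · simp; rfl
    have hV : (p * (n + 1)).choose (p * (k + 1)) =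
        ∑ i ∈ range (p * (k + 1) + 1), p.choose i * (p * n).choose (p * (k + 1) - i) := by
      rw [mul_add, mul_one, add_comm, Nat.add_choose_eq,
        Finset.Nat.sum_antidiagonal_eq_sum_range_succ_mk]
    have hdvd : ∀ j, ¬ p ∣ j →
        p ^ 2 ∣ p.choose j * (p * n).choose (p * (k + 1) - j) := by
      intro j hj
      rcases lt_or_ge p j with h | h
      · simp [Nat.choose_eq_zero_of_lt h]
      · rw [sq]
        refine mul_dvd_mul (by simpa using hp.dvd_choose_mul_of_not_dvd 1 hj)
          (hp.dvd_choose_mul_of_not_dvd n ?_)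
        have hle : j ≤ p * (k + 1) := h.trans (Nat.le_mul_of_pos_right p k.succ_pos)
        rwa [Nat.dvd_sub_iff_right hle (Dvd.intro _ rfl)]
    have hS := (sum_range_mul_modEq hp.pos (k + 1) _ _ hdvd).add_right
      (p.choose (p * (k + 1)) * (p * n).choose (p * (k + 1) - p * (k + 1)))
    have hz : ∀ i ∈ range k, p.choose (p * (i + 1 + 1)) *
        (p * n).choose (p * (k + 1) - p * (i + 1 + 1)) = 0 := by
      intro i _
      rw [Nat.choose_eq_zero_of_lt, zero_mul]
      nlinarith [hp.pos]
    rw [← sum_range_succ, ← hV,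
      ← sum_range_succ (fun i => p.choose (p * i) * (p * n).choose (p * (k + 1) - p * i)),
      sum_range_succ', sum_range_succ', sum_eq_zero hz] at hS
    have h1 : p * (k + 1) - p = p * k := by rw [mul_add, mul_one, Nat.add_sub_cancel]
    simp only [zero_add, mul_one, mul_zero, Nat.choose_self, one_mul, Nat.choose_zero_right,
      Nat.sub_zero, h1] at hS
    rw [Nat.choose_succ_succ]
    exact hS.trans ((ih k).add (ih (k + 1)))

lemma Nat.Prime.sum_choose_modEq_sq (hp : p.Prime) (n : ℕ) :
    ∑ k ∈ range (p * n + 1), (p * n).choose k ^ 2 * (p * n + k).choose k ≡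
      ∑ k ∈ range (n + 1), n.choose k ^ 2 * (n + k).choose k [MOD p ^ 2] := by
  have hdvd : ∀ j, ¬ p ∣ j → p ^ 2 ∣ (p * n).choose j ^ 2 * (p * n + j).choose j :=
    fun j hj => (pow_dvd_pow_of_dvd (hp.dvd_choose_mul_of_not_dvd n hj) 2).mul_right _
  have hS := (sum_range_mul_modEq hp.pos n _ _ hdvd).add_right
    ((p * n).choose (p * n) ^ 2 * (p * n + p * n).choose (p * n))
  rw [← sum_range_succ,
    ← sum_range_succ (fun i => (p * n).choose (p * i) ^ 2 * (p * n + p * i).choose (p * i))] at hS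
  refine hS.trans (Nat.ModEq.sum fun k _ => ?_)
  rw [← mul_add]
  exact ((hp.choose_mul_modEq_sq n k).pow 2).mul (hp.choose_mul_modEq_sq (n + k) k)

end Supercongruence

section Subring

variable {p : ℕ} {R : Subring ℚ}

lemma aperyD_mem (R : Subring ℚ) (n : ℕ) : aperyD n ∈ R :=
  R.sum_mem fun _ _ => R.mul_mem (R.pow_mem (natCast_mem R _) 2) (natCast_mem R _)

lemma harm_mem (hR : ∀ m : ℕ, ¬ p ∣ m → (m : ℚ)⁻¹ ∈ R) {n : ℕ} (hn : n < p) :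
    harm n ∈ R := by
  refine R.sum_mem fun j hj => ?_
  have h := hR (j + 1) (Nat.not_dvd_of_pos_of_lt j.succ_pos (by have := mem_range.1 hj; omega))
  simpa using h

lemma aperyD'_mem (hR : ∀ m : ℕ, ¬ p ∣ m → (m : ℚ)⁻¹ ∈ R) {n : ℕ} (hn : n < p) :
    aperyD' n ∈ R := by
  refine R.mul_mem (natCast_mem R 5) (R.sum_mem fun k hk => ?_)
  have hk' : k < p := by have := mem_range.1 hk; omega
  exact R.mul_mem (R.mul_mem (R.pow_mem (natCast_mem R _) 2) (natCast_mem R _))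
    (R.sub_mem (harm_mem hR hn) (harm_mem hR hk'))

lemma exists_aperyD_mul_prime_sub_eq (hp : p.Prime) (R : Subring ℚ) (n : ℕ) :
    ∃ y : R, aperyD (p * n) - aperyD n = p ^ 2 * y := by
  obtain ⟨d, hd⟩ := (Nat.modEq_iff_dvd.1 (hp.sum_choose_modEq_sq n).symm)
  refine ⟨d, ?_⟩
  have e := congrArg (Int.cast : ℤ → ℚ) hd
  push_cast at e
  simp only [aperyD]
  push_cast
  exact e

lemma exists_aperyD_succ_eq (R : Subring ℚ) (n : ℕ) : ∃ y : R,
    ((n : ℚ) + 1) ^ 2 * aperyD (n + 1) = (11 * n ^ 2 + 11 * n + 3) * aperyD n + n ^ 2 * y := by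
  rcases n with _ | n
  · exact ⟨0, by simp [aperyD_zero, aperyD_one]⟩
  · refine ⟨⟨aperyD n, aperyD_mem R n⟩, ?_⟩
    have h := aperyD_recurrence n
    push_cast
    linear_combination h

@[simp, norm_cast]
lemma Subring.coe_ofNat {K : Type*} [Ring K] (S : Subring K) (m : ℕ) [m.AtLeastTwo] :
    ((ofNat(m) : S) : K) = ofNat(m) :=
  map_ofNat S.subtype m

lemma eq_mul_of_sq_mul_eq {K : Type*} [CommRing K] {d u e q s : K} (hu : d * u = 1)
    (h : d ^ 2 * e = q * s) : e = q * (u ^ 2 * s) := by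
  linear_combination u ^ 2 * h - e * (d * u + 1) * hu

/-- The congruence, in any subring of `ℚ` in which all integers prime to `p` are invertible. -/
lemma exists_aperyD_sub_eq (hp : p.Prime) (hR : ∀ m : ℕ, ¬ p ∣ m → (m : ℚ)⁻¹ ∈ R)
    (n k : ℕ) (hk : k < p) : ∃ y : R,
    aperyD (p * n + k) - aperyD k * aperyD n - p * n * aperyD' k * aperyD n = p ^ 2 * y := by
  have hinv : ∀ j : ℕ, j + 1 < p →
      ∃ u : R, ((p : ℚ) * n + j + 1) * u = 1 := by
    intro j hj
    have hd : ¬ p ∣ p * n + (j + 1) := by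
      rw [Nat.dvd_add_right (Dvd.intro _ rfl)]
      exact Nat.not_dvd_of_pos_of_lt j.succ_pos hj
    refine ⟨⟨_, hR _ hd⟩, ?_⟩
    have h0 : (p : ℚ) * n + j + 1 ≠ 0 := by positivity
    push_cast
    field_simp
    ring
  obtain ⟨a, ha⟩ : ∃ a : R, aperyD n = a := ⟨⟨_, aperyD_mem R n⟩, rfl⟩
  induction k using Nat.twoStepInduction with
  | zero => simpa [aperyD_zero, aperyD'_zero] using exists_aperyD_mul_prime_sub_eq hp R n
  | one =>
    obtain ⟨e, he⟩ := exists_aperyD_mul_prime_sub_eq hp R n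
    obtain ⟨b, hb⟩ := exists_aperyD_succ_eq R (p * n)
    obtain ⟨u, hu⟩ := hinv 0 hk
    rw [aperyD_one, aperyD'_one]
    refine ⟨u ^ 2 * ((11 * (p * n) ^ 2 + 11 * (p * n) + 3) * e + n ^ 2 * b
      - n ^ 2 * a * (2 + 5 * p * n)), ?_⟩
    rw [ha] at he ⊢
    push_cast at hb hu
    refine eq_mul_of_sq_mul_eq hu ?_
    push_cast
    linear_combination hb + (11 * (p * n : ℚ) ^ 2 + 11 * (p * n) + 3) * he
  | more k ih0 ih1 =>
    obtain ⟨e0, h0⟩ := ih0 (by omega)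
    obtain ⟨e1, h1⟩ := ih1 (by omega)
    obtain ⟨u, hu⟩ := hinv (k + 1) hk
    have hA := aperyD_recurrence (p * n + k)
    have hB := aperyD_recurrence k
    have hB' := aperyD'_recurrence k
    obtain ⟨b0, hb0⟩ : ∃ b : R, aperyD k = b := ⟨⟨_, aperyD_mem R _⟩, rfl⟩
    obtain ⟨b1, hb1⟩ : ∃ b : R, aperyD (k + 1) = b := ⟨⟨_, aperyD_mem R _⟩, rfl⟩
    obtain ⟨b2, hb2⟩ : ∃ b : R, aperyD (k + 2) = b := ⟨⟨_, aperyD_mem R _⟩, rfl⟩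
    obtain ⟨c0, hc0⟩ : ∃ c : R, aperyD' k = c := ⟨⟨_, aperyD'_mem hR (by omega)⟩, rfl⟩
    obtain ⟨c1, hc1⟩ : ∃ c : R, aperyD' (k + 1) = c := ⟨⟨_, aperyD'_mem hR (by omega)⟩, rfl⟩
    obtain ⟨c2, hc2⟩ : ∃ c : R, aperyD' (k + 2) = c := ⟨⟨_, aperyD'_mem hR (by omega)⟩, rfl⟩
    refine ⟨u ^ 2 * ((11 * (p * n + k + 1) ^ 2 + 11 * (p * n + k + 1) + 3) * e1
      + (p * n + k + 1) ^ 2 * e0 + n ^ 2 * a * (11 * b1 + (22 * (k + 1) + 11 + 11 * (p * n)) * c1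
      + b0 + (2 * (k + 1) + p * n) * c0 - b2 - (2 * (k + 2) + p * n) * c2)), ?_⟩
    rw [← add_assoc] at h1 ⊢
    rw [ha] at h0 h1 ⊢
    rw [hb0] at h0 hB hB'
    rw [hb1] at h1 hB hB'
    rw [hb2] at hB hB' ⊢
    rw [hc0] at h0 hB'
    rw [hc1] at h1 hB'
    rw [hc2] at hB' ⊢
    push_cast at hA hu
    refine eq_mul_of_sq_mul_eq hu ?_
    push_cast
    linear_combination hA + (11 * (p * n + k + 1 : ℚ) ^ 2 + 11 * (p * n + k + 1) + 3) * h1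
      + (p * n + k + 1 : ℚ) ^ 2 * h0 - a * hB - p * n * a * hB'

end Subring

theorem gessel_lucas_D (p : ℕ) (hp : p.Prime) (hp3 : 3 ≤ p) (n k : ℕ) (hk : k < p) :
    aperyD (p * n + k) - aperyD k * aperyD n - p * n * aperyD' k * aperyD n = 0 ∨
      2 ≤ padicValRat p
        (aperyD (p * n + k) - aperyD k * aperyD n - p * n * aperyD' k * aperyD n) := by
  have : Fact p.Prime := ⟨hp⟩
  have hR : ∀ m : ℕ, ¬ p ∣ m → (m : ℚ)⁻¹ ∈ (Rat.padicValuation p).integer := by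
    intro m hm
    have h : Rat.padicValuation p (m : ℚ) = 1 := by
      rw [← Int.cast_natCast, Rat.padicValuation_cast, Int.padicValuation_eq_one_iff]
      exact_mod_cast hm
    rw [Valuation.mem_integer_iff, map_inv₀, h, inv_one]
  obtain ⟨⟨y, hy⟩, e⟩ := exists_aperyD_sub_eq hp hR n k hk
  rw [e]
  rcases eq_or_ne y 0 with rfl | hy0
  · simp
  right
  have hv : 0 ≤ padicValRat p y := by
    rw [Valuation.mem_integer_iff, Rat.padicValuation_le_one_iff] at hy
    rw [padicValRat, padicValNat.eq_zero_of_not_dvd hy]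
    simp
  have hp0 : (p : ℚ) ≠ 0 := Nat.cast_ne_zero.2 hp.ne_zero
  rw [padicValRat.mul (pow_ne_zero 2 hp0) hy0, padicValRat.pow,
    padicValRat.self hp.one_lt]
  push_cast
  linarith
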